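/- Let n ≥ 4, let G be a weighted complete graph on [n] with edge-weight function w, and set y_{l,m} := w({l,m}) for each 2-element subset {l,m} of [n]. Then for all pairwise distinct i, j, k ∈ [n] there is a reciprocal order f^{i,k}_{j,k} for D_{i,k}(G) and D_{j,k}(G) satisfying f^{i,k}_{j,k}(y_{i,k}) = y_{j,k}, such that the difference multiset of D_{i,k}(G) and D_{j,k}(G) by f^{i,k}_{j,k} can be partitioned into n−2 multisets: one of cardinality N_{n−1}+1 consisting of one element y_{i,k} − y_{j,k} and N_{n−1} elements equal to −(y_{i,k} − y_{j,k}), and, for each r ∈ [n] ∖ {i,j,k}, one of cardinality N_{n−1} consisting of N_{n−2} elements equal to y_{r,i} − y_{r,j} and N_{n−1} − N_{n−2} elements equal to −(y_{r,i} − y_{r,j}); moreover D_{u,v}(G) = h_{u,v}({y_{l,m}}) for all distinct u, v ∈ [n]. -/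

import Mathlib

/-- The weight of a path, given as the list of its vertices: the sum of the weights of
consecutive pairs of vertices. -/
def pathWeight {n : ℕ} (w : Fin n → Fin n → ℝ) : List (Fin n) → ℝ
  | a :: b :: rest => w a b + pathWeight w (b :: rest)
  | _ => 0

/-- `p` is (the vertex list of) a simple path between `i` and `j`: its vertices are pairwise
distinct, it starts at `i` and ends at `j`. -/
def IsPath {n : ℕ} (i j : Fin n) (p : List (Fin n)) : Prop :=
  p.Nodup ∧ p.head? = some i ∧ p.getLast? = some j

/-- `Nn n = ∑_{k=1}^{n-1} (n-2)!/(n-1-k)!`, the number of simple paths between two fixed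
distinct vertices of the complete graph `K_n`. -/
def Nn (n : ℕ) : ℕ := ∑ k ∈ Finset.Icc 1 (n - 1), Nat.factorial (n - 2) / Nat.factorial (n - 1 - k)

noncomputable instance {n : ℕ} (i j : Fin n) : Fintype {p : List (Fin n) // IsPath i j p} :=
  Fintype.ofInjective (fun p => (⟨p.1, p.2.1⟩ : {l : List (Fin n) // l.Nodup}))
    (by intro p q h; cases p; cases q; simpa [Subtype.ext_iff] using h)

/-- The finite set of (vertex lists of) simple paths between `i` and `j` in `K_n`. -/
noncomputable def pathFinset (n : ℕ) (i j : Fin n) : Finset (List (Fin n)) :=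
  (Finset.univ : Finset {p : List (Fin n) // IsPath i j p}).map
    ⟨Subtype.val, Subtype.val_injective⟩

/-- `DG n w i j` is the multiset of the weights of all simple paths between `i` and `j`. -/
noncomputable def DG (n : ℕ) (w : Fin n → Fin n → ℝ) (i j : Fin n) : Multiset ℝ :=
  (pathFinset n i j).val.map (pathWeight w)

/-- `hMultiset n y u v` is the multiset of all sums
`y u i₁ + y i₁ i₂ + ⋯ + y i_{r-1} i_r + y i_r v` over `r ≥ 0` and pairwise distinct
`i₁, …, i_r ∈ [n] ∖ {u,v}`. -/
noncomputable def hMultiset (n : ℕ) (y : Fin n → Fin n → ℝ) (u v : Fin n) : Multiset ℝ :=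
  (pathFinset n u v).val.map (pathWeight y)

open Finset in
/-- The finite set of duplicate-free lists with entries in `S`. -/
noncomputable def nodupLists {α : Type*} [Fintype α] [DecidableEq α] (S : Finset α) :
    Finset (List α) :=
  ((univ : Finset {l : List α // l.Nodup}).map ⟨Subtype.val, Subtype.val_injective⟩).filter
    (fun l => ∀ x ∈ l, x ∈ S)

lemma Finset.map_val_comp_eq_sum_replicate {ι α β : Type*} [DecidableEq α] (s : Finset ι) (t : Finset α)
    (f : ι → α) (g : α → β) (h : ∀ x ∈ s, f x ∈ t) :
    s.val.map (fun x => g (f x)) =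
      ∑ v ∈ t, Multiset.replicate (s.filter (fun x => f x = v)).card (g v) := by
  classical
  induction s using Finset.induction_on with
  | empty => simp
  | insert a s ha ih =>
    rw [Finset.insert_val_of_notMem ha, Multiset.map_cons, ih fun x hx => h x (by simp [hx])]
    have hv : ∀ v, Multiset.replicate ((insert a s).filter (fun x => f x = v)).card (g v) =
        (if f a = v then {g v} else 0) +
          Multiset.replicate (s.filter (fun x => f x = v)).card (g v) := by
      intro v
      rw [Finset.filter_insert]
      split_ifs with hav
      · rw [Finset.card_insert_of_notMem (by simp [ha]), Multiset.replicate_succ,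
          Multiset.singleton_add]
      · simp
    simp only [hv]
    rw [Finset.sum_add_distrib, Finset.sum_ite_eq, if_pos (h a (by simp)),
      Multiset.singleton_add]

lemma Nn_two : Nn 2 = 1 := rfl

lemma Nn_add_three (m : ℕ) : Nn (m + 3) = (m + 1) * Nn (m + 2) + 1 := by
  have h (m : ℕ) : Nn (m + 2) =
      ∑ k ∈ Finset.range (m + 1), m.factorial / k.factorial := by
    rw [Nn, show m + 2 - 1 = m + 1 by omega, ← Finset.sum_range_reflect]
    refine Finset.sum_bij (fun k _ => k - 1) ?_ ?_ ?_ ?_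
    all_goals simp only [Finset.mem_Icc, Finset.mem_range]
    · omega
    · omega
    · intro b hb
      exact ⟨b + 1, by omega, by omega⟩
    · intro k hk
      congr 2
      omega
  rw [h (m + 1), h m, Finset.sum_range_succ, Nat.div_self (Nat.factorial_pos _), Finset.mul_sum]
  congr 1
  refine Finset.sum_congr rfl fun k hk => ?_
  rw [Nat.factorial_succ, Nat.mul_div_assoc]
  exact Nat.factorial_dvd_factorial (by simpa [Nat.lt_succ_iff] using hk)

lemma headD_mem_insert {α : Type*} [DecidableEq α] {S : Finset α} {l : List α} (hl : ∀ x ∈ l, x ∈ S) (k : α) :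
    l.headD k ∈ insert k S := by
  cases l with
  | nil => simp
  | cons a l => simp [hl a]

section Counting

variable {α : Type*} [Fintype α] [DecidableEq α]

@[simp]
lemma mem_nodupLists {S : Finset α} {l : List α} :
    l ∈ nodupLists S ↔ l.Nodup ∧ ∀ x ∈ l, x ∈ S := by
  simp [nodupLists]

/-- The finite set of pairs of disjoint duplicate-free lists with entries in `S`. -/
noncomputable def nodupListPairs (S : Finset α) : Finset (List α × List α) :=
  (nodupLists S ×ˢ nodupLists S).filter (fun p => (p.1 ++ p.2).Nodup)

@[simp]
lemma mem_nodupListPairs {S : Finset α} {p : List α × List α} :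
    p ∈ nodupListPairs S ↔ (p.1 ++ p.2).Nodup ∧ ∀ x ∈ p.1 ++ p.2, x ∈ S := by
  simp only [nodupListPairs, Finset.mem_filter, Finset.mem_product, mem_nodupLists,
    List.nodup_append, List.mem_append]
  grind

lemma card_filter_headD_eq {S : Finset α} {k r : α} (hk : k ∉ S) (hr : r ∈ S) :
    ((nodupLists S).filter (fun l => l.headD k = r)).card = (nodupLists (S.erase r)).card := by
  symm
  refine Finset.card_bij (fun l _ => r :: l) ?_ ?_ ?_
  · intro l hl
    simp only [mem_nodupLists, Finset.mem_filter] at hl ⊢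
    grind
  · intro a _ b _ h
    exact (List.cons.inj h).2
  · intro l hl
    simp only [mem_nodupLists, Finset.mem_filter] at hl
    cases l with
    | nil => exact absurd hr (by simpa [← hl.2] using hk)
    | cons a l =>
      simp only [List.headD_cons] at hl
      refine ⟨l, ?_, by simp [hl.2]⟩
      simp only [mem_nodupLists]
      grind

lemma filter_headD_eq_default {S : Finset α} {k : α} (hk : k ∉ S) :
    (nodupLists S).filter (fun l => l.headD k = k) = {[]} := by
  ext l
  simp only [mem_nodupLists, Finset.mem_filter, Finset.mem_singleton]
  cases l <;> grind

lemma card_filter_snd_headD_eq_default {S : Finset α} {k : α} (hk : k ∉ S) :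
    ((nodupListPairs S).filter (fun p => p.2.headD k = k)).card = (nodupLists S).card := by
  symm
  refine Finset.card_bij (fun l _ => (l, [])) ?_ ?_ ?_
  · intro l hl
    simpa using hl
  · intro a _ b _ h
    exact (Prod.mk.inj h).1
  · rintro ⟨P, Q⟩ hl
    simp only [mem_nodupListPairs, Finset.mem_filter] at hl
    cases Q with
    | nil => exact ⟨P, by simpa using hl.1, rfl⟩
    | cons a l => grind

lemma card_filter_snd_headD_eq {S : Finset α} {k r : α} (hk : k ∉ S) (hr : r ∈ S) :
    ((nodupListPairs S).filter (fun p => p.2.headD k = r)).card =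
      (nodupLists S).card - (nodupLists (S.erase r)).card := by
  have h1 : (nodupLists S).filter (fun l => r ∉ l) = nodupLists (S.erase r) := by
    ext l
    simp only [mem_nodupLists, Finset.mem_filter, Finset.mem_erase]
    grind
  have h2 := Finset.card_filter_add_card_filter_not (s := nodupLists S) (fun l => r ∈ l)
  rw [h1] at h2
  rw [← h2, Nat.add_sub_cancel]
  refine Finset.card_bij (fun p _ => p.1 ++ p.2) ?_ ?_ ?_
  · rintro ⟨P, Q⟩ h
    simp only [mem_nodupListPairs, mem_nodupLists, Finset.mem_filter] at h ⊢
    refine ⟨h.1, ?_⟩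
    cases Q <;> grind
  · rintro ⟨P, Q⟩ h ⟨P', Q'⟩ h' heq
    simp only [mem_nodupListPairs, Finset.mem_filter] at h h' heq
    cases Q with
    | nil => grind
    | cons a Q =>
      cases Q' with
      | nil => grind
      | cons b Q' =>
        simp only [List.headD_cons] at h h'
        obtain ⟨⟨h, -⟩, rfl⟩ := h
        obtain ⟨⟨h', -⟩, rfl⟩ := h'
        have := List.append_cons_inj_of_notMem (x₁ := P) (x₂ := P') (z₁ := Q) (z₂ := Q') (a₁ := b)
          (a₂ := b)
        grind
  · intro l hl
    simp only [mem_nodupLists, Finset.mem_filter] at hl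
    obtain ⟨P, Q, rfl⟩ := List.append_of_mem hl.2
    exact ⟨(P, r :: Q), by simpa using hl.1, rfl⟩

lemma card_nodupLists (m : ℕ) (S : Finset α) (hS : S.card = m) :
    (nodupLists S).card = Nn (m + 2) := by
  induction m generalizing S with
  | zero =>
    obtain rfl := Finset.card_eq_zero.mp hS
    have : nodupLists (∅ : Finset α) = {[]} := by
      ext l
      cases l with
      | nil => simp
      | cons a l => simpa using fun _ _ => ⟨a, by simp⟩
    simp [this, Nn_two]
  | succ m ih =>
    have hne : (nodupLists S).card =
        ((nodupLists S).filter (fun l => l.head? = none)).card +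
        ∑ r ∈ S, ((nodupLists S).filter (fun l => l.head? = some r)).card := by
      rw [Finset.card_eq_sum_card_fiberwise (f := List.head?) (t := Finset.insertNone S),
        Finset.sum_insertNone]
      intro l hl
      cases l <;> simp_all
    have h0 : (nodupLists S).filter (fun l => l.head? = none) = {[]} := by
      ext l
      cases l <;> simp
    have h1 : ∀ r ∈ S, ((nodupLists S).filter (fun l => l.head? = some r)).card =
        Nn (m + 2) := by
      intro r hr
      rw [← ih (S.erase r) (by rw [Finset.card_erase_of_mem hr, hS, Nat.add_sub_cancel])]
      symm
      refine Finset.card_bij (fun l _ => r :: l) ?_ ?_ ?_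
      · intro l hl
        simp only [mem_nodupLists, Finset.mem_filter] at hl ⊢
        grind
      · intro a _ b _ h
        exact (List.cons.inj h).2
      · intro l hl
        simp only [mem_nodupLists, Finset.mem_filter] at hl
        cases l with
        | nil => simp at hl
        | cons a l =>
          refine ⟨l, ?_, by simp_all⟩
          simp only [mem_nodupLists]
          grind
    rw [hne, h0, Finset.sum_congr rfl h1, Finset.sum_const, hS, Nn_add_three]
    simp [add_comm]

end Counting

section Weights

variable {n : ℕ} (w : Fin n → Fin n → ℝ)

lemma pathWeight_append_cons (l₁ : List (Fin n)) (a : Fin n) (l₂ : List (Fin n)) :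
    pathWeight w (l₁ ++ a :: l₂) = pathWeight w (l₁ ++ [a]) + pathWeight w (a :: l₂) := by
  induction l₁ with
  | nil => simp [pathWeight]
  | cons b l₁ ih =>
    cases l₁ with
    | nil => simp [pathWeight]
    | cons c l₁ =>
      simp only [List.cons_append, pathWeight] at ih ⊢
      rw [ih, add_assoc]

lemma pathWeight_reverse (hw : ∀ a b, w a b = w b a) (l : List (Fin n)) :
    pathWeight w l.reverse = pathWeight w l := by
  induction l with
  | nil => rfl
  | cons a l ih =>
    cases l with
    | nil => rfl
    | cons b l =>
      rw [List.reverse_cons, List.reverse_cons, List.append_assoc, List.singleton_append,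
        pathWeight_append_cons, ← List.reverse_cons, ih]
      simp [pathWeight, hw a b, add_comm]

lemma pathWeight_cons_append_singleton_sub (i j k : Fin n) (l : List (Fin n)) :
    pathWeight w (i :: (l ++ [k])) - pathWeight w (j :: (l ++ [k])) =
      w i (l.headD k) - w j (l.headD k) := by
  cases l <;> simp [pathWeight]

lemma pathWeight_swap_sub (hw : ∀ a b, w a b = w b a) (i j k : Fin n) (P Q : List (Fin n)) :
    pathWeight w (i :: (P ++ j :: (Q ++ [k]))) -
        pathWeight w (j :: (P.reverse ++ i :: (Q ++ [k]))) =
      -(w i (Q.headD k) - w j (Q.headD k)) := by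
  have h1 := pathWeight_append_cons w (i :: P) j (Q ++ [k])
  have h2 := pathWeight_append_cons w (j :: P.reverse) i (Q ++ [k])
  have h3 := pathWeight_reverse w hw (i :: (P ++ [j]))
  have h4 := pathWeight_cons_append_singleton_sub w i j k Q
  simp only [List.reverse_cons, List.reverse_append, List.reverse_nil, List.nil_append,
    List.cons_append] at h1 h2 h3
  linarith

lemma mem_pathFinset {i k : Fin n} {p : List (Fin n)} :
    p ∈ pathFinset n i k ↔ IsPath i k p := by
  simp [pathFinset]

lemma isPath_iff {i k : Fin n} (hik : i ≠ k) {p : List (Fin n)} :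
    IsPath i k p ↔ ∃ l : List (Fin n), p = i :: (l ++ [k]) ∧ l.Nodup ∧ i ∉ l ∧ k ∉ l := by
  constructor
  · rintro ⟨hnd, hh, hl⟩
    obtain ⟨t, rfl⟩ := List.head?_eq_some_iff.mp hh
    obtain ⟨s, hs⟩ := List.getLast?_eq_some_iff.mp hl
    cases s with
    | nil => simp_all
    | cons a l =>
      obtain ⟨rfl, rfl⟩ := List.cons.inj hs
      refine ⟨l, rfl, ?_⟩
      grind
  · rintro ⟨l, rfl, hnd, hi, hk⟩
    refine ⟨by grind, by simp, ?_⟩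
    rw [← List.cons_append, List.getLast?_append]
    simp

/-- A path from `i` to `k` either avoids `j` or splits at `j`. -/
lemma DG_eq_add {i j k : Fin n} (hij : i ≠ j) (hik : i ≠ k) (hjk : j ≠ k) (S : Finset (Fin n))
    (hS : ∀ r, r ∈ S ↔ r ≠ i ∧ r ≠ j ∧ r ≠ k) :
    DG n w i k = (nodupLists S).val.map (fun l => pathWeight w (i :: (l ++ [k]))) +
      (nodupListPairs S).val.map
        (fun p => pathWeight w (i :: (p.1 ++ j :: (p.2 ++ [k])))) := by
  let f : List (Fin n) → List (Fin n) := fun l => i :: (l ++ [k])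
  let g : List (Fin n) × List (Fin n) → List (Fin n) :=
    fun p => i :: (p.1 ++ j :: (p.2 ++ [k]))
  suffices h : (pathFinset n i k).val =
      (nodupLists S).val.map f + (nodupListPairs S).val.map g by
    rw [DG, h, Multiset.map_add, Multiset.map_map, Multiset.map_map]
    rfl
  have hf : Set.InjOn f (nodupLists S : Set (List (Fin n))) := by
    intro a _ b _ h
    simpa [f] using h
  have hg : Set.InjOn g (nodupListPairs S : Set (List (Fin n) × List (Fin n))) := by
    rintro ⟨P, Q⟩ h ⟨P', Q'⟩ h' heq
    simp only [Finset.mem_coe, mem_nodupListPairs, g, List.cons.injEq, true_and] at h h' heq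
    have hP : j ∉ P := fun hj => ((hS j).mp (h.2 j (by simp [hj]))).2.1 rfl
    have hQ : j ∉ Q ++ [k] := fun hj => by
      rcases List.mem_append.mp hj with hj | hj
      · exact ((hS j).mp (h.2 j (by simp [hj]))).2.1 rfl
      · exact hjk (List.mem_singleton.mp hj)
    simpa using (List.append_cons_inj_of_notMem hP hQ).mp heq
  rw [← Finset.image_val_of_injOn hf, ← Finset.image_val_of_injOn hg]
  have hd : Disjoint ((nodupLists S).image f) ((nodupListPairs S).image g) := by
    rw [Finset.disjoint_left]
    intro p hp hp'
    simp only [Finset.mem_image, mem_nodupLists, mem_nodupListPairs, f, g] at hp hp'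
    obtain ⟨l, hl, rfl⟩ := hp
    obtain ⟨⟨P, Q⟩, hPQ, heq⟩ := hp'
    have : j ∈ l ++ [k] := by
      rw [← (List.cons.inj heq).2]
      simp
    grind
  rw [← Finset.disjUnion_val _ _ hd, Finset.val_inj]
  ext p
  rw [mem_pathFinset, isPath_iff hik, Finset.mem_disjUnion]
  simp only [Finset.mem_image, mem_nodupLists, mem_nodupListPairs, f, g]
  constructor
  · rintro ⟨l, rfl, hnd, hi, hk⟩
    by_cases hj : j ∈ l
    · obtain ⟨P, Q, rfl⟩ := List.append_of_mem hj
      refine Or.inr ⟨(P, Q), ?_, by simp⟩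
      grind
    · exact Or.inl ⟨l, ⟨hnd, by grind⟩, rfl⟩
  · rintro (⟨l, ⟨hnd, hl⟩, rfl⟩ | ⟨⟨P, Q⟩, ⟨hnd, hl⟩, rfl⟩)
    · exact ⟨l, rfl, hnd, by grind, by grind⟩
    · have hi : i ∉ P ++ Q := fun h => ((hS i).mp (hl i h)).1 rfl
      have hj : j ∉ P ++ Q := fun h => ((hS j).mp (hl j h)).2.1 rfl
      have hk : k ∉ P ++ Q := fun h => ((hS k).mp (hl k h)).2.2 rfl
      exact ⟨P ++ j :: Q, by simp, List.nodup_middle.mpr (List.nodup_cons.mpr ⟨hj, hnd⟩),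
        by grind, by grind⟩

end Weights

lemma nodupListPairs_map_reverse_fst {α β : Type*} [Fintype α] [DecidableEq α] (S : Finset α)
    (f : List α × List α → β) :
    (nodupListPairs S).val.map (fun p => f (p.1.reverse, p.2)) =
      (nodupListPairs S).val.map f := by
  refine Multiset.map_eq_map_of_bij_of_nodup _ _ (nodupListPairs S).nodup
    (nodupListPairs S).nodup (fun p _ => (p.1.reverse, p.2)) ?_ ?_ ?_ ?_
  · rintro ⟨P, Q⟩ h
    simp only [Finset.mem_val, mem_nodupListPairs] at h ⊢
    grind
  · rintro ⟨P, Q⟩ _ ⟨P', Q'⟩ _ h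
    simpa using h
  · rintro ⟨P, Q⟩ h
    refine ⟨(P.reverse, Q), ?_, by simp⟩
    simp only [Finset.mem_val, mem_nodupListPairs] at h ⊢
    grind
  · simp

lemma Multiset.exists_univ_val_map_eq {α : Type*} (M : Multiset α) {m : ℕ}
    (hM : Multiset.card M = m) :
    ∃ g : Fin m → α, (Finset.univ : Finset (Fin m)).val.map g = M := by
  subst hM
  induction M using Quotient.inductionOn with
  | h l => exact ⟨l.get, (Fin.univ_val_map l.get).trans (by rw [List.ofFn_get]; rfl)⟩

/-- For a weighted complete graph `G` on `[n]` with edge weights `w` (and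
`y_{l,m} := w({l,m})`): for all pairwise distinct `i, j, k` there is a reciprocal order `g` for
`D_{i,k}(G)` and `D_{j,k}(G)` matching `y_{i,k}` with `y_{j,k}` whose difference multiset
consists of one copy of `y_{i,k} - y_{j,k}`, `N_{n-1}` copies of its opposite, and for each
`r ∈ [n] ∖ {i,j,k}`, `N_{n-2}` copies of `y_{r,i} - y_{r,j}` and `N_{n-1} - N_{n-2}` copies of
its opposite; moreover `D_{u,v}(G) = h_{u,v}({y_{l,m}})` for all distinct `u, v`. -/
theorem stmt_15 (n : ℕ) (hn : 4 ≤ n) (w : Fin n → Fin n → ℝ) (hw : ∀ a b, w a b = w b a) :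
    (∀ i j k : Fin n, i ≠ j → i ≠ k → j ≠ k →
      ∃ g : Fin (Nn n) → ℝ × ℝ,
        ((Finset.univ : Finset (Fin (Nn n))).val.map (fun x => (g x).1) = DG n w i k) ∧
        ((Finset.univ : Finset (Fin (Nn n))).val.map (fun x => (g x).2) = DG n w j k) ∧
        (∃ x : Fin (Nn n), g x = (w i k, w j k)) ∧
        ((Finset.univ : Finset (Fin (Nn n))).val.map (fun x => (g x).1 - (g x).2) =
          ({w i k - w j k} : Multiset ℝ)
          + Multiset.replicate (Nn (n - 1)) (-(w i k - w j k))
          + (Finset.filter (fun r : Fin n => r ≠ i ∧ r ≠ j ∧ r ≠ k) Finset.univ).val.bind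
              (fun r => Multiset.replicate (Nn (n - 2)) (w i r - w j r)
                + Multiset.replicate (Nn (n - 1) - Nn (n - 2)) (-(w i r - w j r))))) ∧
    (∀ u v : Fin n, u ≠ v → DG n w u v = hMultiset n w u v) := by
  refine ⟨fun i j k hij hik hjk => ?_, fun u v _ => rfl⟩
  obtain ⟨m, rfl⟩ : ∃ m, n = m + 4 := ⟨n - 4, by omega⟩
  rw [show m + 4 - 1 = m + 3 by omega, show m + 4 - 2 = m + 2 by omega]
  have hS : ∀ r, r ∈ Finset.filter (fun r => r ≠ i ∧ r ≠ j ∧ r ≠ k) Finset.univ ↔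
      r ≠ i ∧ r ≠ j ∧ r ≠ k := by simp
  generalize Finset.filter (fun r => r ≠ i ∧ r ≠ j ∧ r ≠ k) Finset.univ = S at hS ⊢
  have hkS : k ∉ S := by simp [hS]
  have hcard : S.card = m + 1 := by
    have : S = ({i, j, k} : Finset (Fin (m + 4)))ᶜ := by
      ext r
      simp [hS]
    rw [this, Finset.card_compl, Fintype.card_fin, Finset.card_eq_three.mpr ⟨i, j, k, hij, hik,
      hjk, rfl⟩]
    omega
  have hNS : (nodupLists S).card = Nn (m + 3) := card_nodupLists _ S hcard
  have hNSr : ∀ r ∈ S, (nodupLists (S.erase r)).card = Nn (m + 2) := fun r hr =>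
    card_nodupLists _ _ (by rw [Finset.card_erase_of_mem hr, hcard, Nat.add_sub_cancel])
  let M : Multiset (ℝ × ℝ) :=
    (nodupLists S).val.map
      (fun l => (pathWeight w (i :: (l ++ [k])), pathWeight w (j :: (l ++ [k])))) +
    (nodupListPairs S).val.map
      (fun p => (pathWeight w (i :: (p.1 ++ j :: (p.2 ++ [k]))),
        pathWeight w (j :: (p.1.reverse ++ i :: (p.2 ++ [k])))))
  have hdiff : M.map (fun x => x.1 - x.2) = ({w i k - w j k} : Multiset ℝ)
      + Multiset.replicate (Nn (m + 3)) (-(w i k - w j k))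
      + S.val.bind (fun r => Multiset.replicate (Nn (m + 2)) (w i r - w j r)
          + Multiset.replicate (Nn (m + 3) - Nn (m + 2)) (-(w i r - w j r))) := by
    simp only [M, Multiset.map_add, Multiset.map_map, Function.comp_def,
      pathWeight_cons_append_singleton_sub, pathWeight_swap_sub w hw]
    rw [Finset.map_val_comp_eq_sum_replicate (nodupLists S) (insert k S) (fun l => l.headD k)
        (fun v => w i v - w j v),
      Finset.map_val_comp_eq_sum_replicate (nodupListPairs S) (insert k S)
        (fun p => p.2.headD k) (fun v => -(w i v - w j v)),
      Finset.sum_insert hkS, Finset.sum_insert hkS, filter_headD_eq_default hkS,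
      card_filter_snd_headD_eq_default hkS, hNS, Finset.card_singleton,
      Multiset.replicate_one, add_add_add_comm, ← Finset.sum_add_distrib]
    · rw [Multiset.bind, Multiset.join, ← Finset.sum_eq_multiset_sum]
      refine congrArg (_ + ·) (Finset.sum_congr rfl fun r hr => ?_)
      rw [card_filter_headD_eq hkS hr, card_filter_snd_headD_eq hkS hr, hNS, hNSr r hr]
    · exact fun p hp => headD_mem_insert
        (fun x hx => (mem_nodupListPairs.mp hp).2 x (List.mem_append_right _ hx)) k
    · exact fun l hl => headD_mem_insert (mem_nodupLists.mp hl).2 k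
  have hM : Multiset.card M = Nn (m + 4) := by
    have h := congrArg Multiset.card hdiff
    have hle : Nn (m + 2) ≤ Nn (m + 3) := by
      rw [Nn_add_three]
      nlinarith
    simp only [Multiset.card_map, Multiset.card_add, Multiset.card_singleton,
      Multiset.card_replicate, Multiset.card_bind, Function.comp_def, Multiset.map_const',
      Multiset.sum_replicate, Nat.add_sub_cancel' hle, smul_eq_mul, Finset.card_val, hcard] at h
    rw [h, Nn_add_three (m + 1)]
    ring
  obtain ⟨g, hg⟩ := Multiset.exists_univ_val_map_eq M hM
  have hmap : ∀ f : ℝ × ℝ → ℝ, Finset.univ.val.map (fun x => f (g x)) = M.map f := by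
    intro f
    rw [← hg, Multiset.map_map]
    rfl
  refine ⟨g, ?_, ?_, ?_, ?_⟩
  · rw [hmap Prod.fst, DG_eq_add w hij hik hjk S hS]
    simp [M, Multiset.map_map]
  · rw [hmap Prod.snd, DG_eq_add w hij.symm hjk hik S fun r => (hS r).trans and_left_comm,
      ← nodupListPairs_map_reverse_fst]
    simp [M, Multiset.map_map]
  · have : (w i k, w j k) ∈ M :=
      Multiset.mem_add.mpr (Or.inl (Multiset.mem_map.mpr ⟨[], by simp, by simp [pathWeight]⟩))
    rw [← hg] at this
    simpa using this
  · rw [hmap fun x => x.1 - x.2, hdiff]
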